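/- Fix n, d ≥ 1, a nonzero D ∈ ℝ^{n×d} with σ > 0 the smallest positive eigenvalue of DD^⊤, ρ > 0, weights σ_i ≥ 0 and a convex, monotonically increasing, nonnegative loss l defining Ω(z) = Σ_{i=1}^n σ_i l(z_{[i]}), and a proper, lower semicontinuous, c-weakly convex, nonnegative g : ℝ^d → ℝ ∪ {+∞}. Let 0 < cγ ≤ 1/3 and r > γ^{-1}, write M = M_{g,γ}, define L^M_ρ(w, z; λ) = Ω(z) + ⟨λ, z − Dw⟩ + (ρ/2)‖z − Dw‖² + M(w) and Φ^k = L^M_ρ(w^k, z^k; λ^k) + (2r²/(σρ))‖w^k − w^{k−1}‖², and set E₁ = (2r − γ^{-1})/2 − 4r²/(σρ) − 2/(σργ²). Suppose E₁ > 0, that for all k the smoothed-ADMM iterates satisfy: L^M_ρ(w^k, z^k; λ^k) ≥ L^M_ρ(w^k, z^{k+1}; λ^k); w^{k+1} minimizes w ↦ (ρ/2)‖z^{k+1} − Dw + λ^k/ρ‖² + M(w) + (r/2)‖w − w^k‖²; λ^{k+1} = λ^k + ρ(z^{k+1} − Dw^{k+1}); z^k ∈ Im(D); and further that ‖λ^k‖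 ≤ Λ for all k and ‖∇M(w)‖ ≤ M_b for all w ∈ ℝ^d. Then for every integer K ≥ 1 there exists k with 1 ≤ k ≤ K such that, writing B = Φ¹ + Λ²/(2ρ) and w̃^{k+1} = prox_{g,γ}(w^{k+1}): (i) ‖w^{k+1} − w^k‖ ≤ √(B/(E₁K)) and ‖λ^{k+1} − λ^k‖ ≤ √(ρB/K); (ii) there exists a c-subgradient v of g at w̃^{k+1} with ‖D^⊤λ^{k+1} − v‖ ≤ r·√(B/(E₁K)), and the vector ξ = −λ^k − ρ(z^{k+1} − Dw^k) satisfies ‖ξ + λ^{k+1}‖ ≤ ρ‖D‖·√(B/(E₁K)); and (iii) ‖z^{k+1} − Dw̃^{k+1}‖ ≤ √(B/(ρK)) + γ‖D‖M_b. In particular, with the parameter choices γ = ε ≤ 1/(3c), ρ = C₁/ε, r = C₂/ε for constants C₂ > 1 and C₁ > (8C₂² + 1/(3c) + 4)/(σ(2C₂ − 1)), the triple (z^{k+1}, w̃^{k+1}, λ^{k+1}) is an ε-KKT point within O(1/ε⁴) iterations. -/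

import Mathlib

open scoped RealInnerProductSpace BigOperators

namespace ADMMAux

/-- Elementary consequences of `E₁ > 0`. -/
lemma s_lower {s r τ : ℝ} (hτ : 0 < τ) (hr : τ < r)
    (he : 0 < s * (r - τ / 2) - (4 * r ^ 2 + 2 * τ ^ 2)) : 2 * (2 * r + τ) ≤ s := by
  by_contra h
  push Not at h
  nlinarith [mul_pos (sub_pos.2 h) (show 0 < r - τ / 2 by linarith), sq_nonneg τ]

lemma mid_bound {s r τ : ℝ} (hτ : 0 < τ) (hr : τ < r) (hs : 2 * (2 * r + τ) ≤ s) {A p : ℝ} :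
    4 * (τ * A + r * p) ^ 2 + 4 * r ^ 2 * p ^ 2
      ≤ (4 * r ^ 2 + 2 * τ ^ 2) * A ^ 2 + s ^ 2 / 2 * p ^ 2 := by
  have h1 : 2 * (2 * r + τ) ^ 2 ≤ s ^ 2 / 2 := by nlinarith
  have h2 : 2 * (2 * r + τ) ^ 2 * p ^ 2 ≤ s ^ 2 / 2 * p ^ 2 :=
    mul_le_mul_of_nonneg_right h1 (sq_nonneg p)
  have h3 : 0 ≤ (4 * r ^ 2 - 2 * τ ^ 2) * A ^ 2 - 8 * (r * τ) * (A * p)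
      + (8 * (r * τ) + 2 * τ ^ 2) * p ^ 2 := by
    have hx : 0 < r - τ := sub_pos.2 hr
    have e2 : (4 * r ^ 2 - 2 * τ ^ 2) * A ^ 2 - 8 * (r * τ) * (A * p)
      + (8 * (r * τ) + 2 * τ ^ 2) * p ^ 2
      = 4 * (r - τ) ^ 2 * A ^ 2 + 8 * (τ * (r - τ)) * (A ^ 2 - A * p + p ^ 2)
        + τ ^ 2 * (2 * (A - 2 * p) ^ 2 + 2 * p ^ 2) := by ring
    rw [e2]
    have : 0 ≤ A ^ 2 - A * p + p ^ 2 := by nlinarith [sq_nonneg (A - p), sq_nonneg (A + p)]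
    positivity
  nlinarith

lemma two_sq (u x : ℝ) : (u + x) ^ 2 ≤ 2 * u ^ 2 + 2 * x ^ 2 := by
  nlinarith [sq_nonneg (u - x)]

set_option maxHeartbeats 1000000 in
/-- Sharp bound for the first step. -/
lemma first_step {s r τ e t y A p A0 : ℝ} (hτ : 0 < τ) (hr : τ < r)
    (he : e = s * (r - τ / 2) - (4 * r ^ 2 + 2 * τ ^ 2)) (hepos : 0 < e)
    (hqe : 4 * r ^ 2 + 2 * τ ^ 2 < e) (ht : 0 ≤ t) (hty : t < y) (hA : 0 ≤ A) (hp : 0 ≤ p)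
    (hy : y ≤ (τ * A + r * p + r * A0) ^ 2) :
    (e - (4 * r ^ 2 + 2 * τ ^ 2)) * t ≤
      e * ((e + (4 * r ^ 2 + 2 * τ ^ 2)) * A ^ 2 + s ^ 2 / 2 * p ^ 2 - y
        + 2 * r ^ 2 * A0 ^ 2 - 4 * r ^ 2 * p ^ 2) := by
  have hs : 2 * (2 * r + τ) ≤ s := s_lower hτ hr (he ▸ hepos)
  have hr0 : 0 < r := hτ.trans hr
  have hs0 : 0 < s := by linarith
  set q := 4 * r ^ 2 + 2 * τ ^ 2 with hq
  have hq0 : 0 < q := by positivity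
  set u := τ * A + r * p with hu
  set x := r * A0 with hx
  -- weighted Young
  have hY : q * e * ((e - q) * t) ≤ q * e * (e * (2 * x ^ 2 - y)) + 4 * e ^ 3 * u ^ 2 := by
    -- y ≤ (1+η) x² + (1+1/η) u², η = q/(2e)
    have h1 : y * (2 * e * q) ≤ (2 * e + q) * q * x ^ 2 + (q + 2 * e) * (2 * e) * u ^ 2 := by
      have : y * (2 * e * q) ≤ (u + x) ^ 2 * (2 * e * q) :=
        mul_le_mul_of_nonneg_right hy (by positivity)
      nlinarith [sq_nonneg (q * x - 2 * e * u)]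
    have h2 : (e - q) * t * (2 * e + q) ≤ y * e * (2 * e - q) := by
      have h3 : (e - q) * t * (2 * e + q) ≤ (e - q) * y * (2 * e + q) := by
        have : 0 ≤ e - q := by linarith
        gcongr
      have h4 : 0 ≤ y * q ^ 2 := by
        have : 0 ≤ y := by linarith
        positivity
      nlinarith [mul_nonneg h4 hepos.le]
    have hpos : 0 < 2 * e + q := by positivity
    refine le_of_mul_le_mul_right ?_ hpos
    have h5 := mul_le_mul_of_nonneg_left h1 (show 0 ≤ 2 * e ^ 2 by positivity)
    have h6 := mul_le_mul_of_nonneg_left h2 (show 0 ≤ q * e by positivity)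
    nlinarith
  have hU : 4 * e * u ^ 2 ≤ q * ((e + q) * A ^ 2 + (s ^ 2 / 2 - 4 * r ^ 2) * p ^ 2) := by
    have hα : 0 < r - τ / 2 := by linarith
    have hAp : 0 ≤ A * p := mul_nonneg hA hp
    have k1 : 8 * (r * τ) * (A * p) ≤ (4 * r ^ 2 - 2 * τ ^ 2) * A ^ 2 + 8 * τ ^ 2 * p ^ 2 := by
      nlinarith [sq_nonneg (r * A - τ * p), sq_nonneg (r * A - 2 * (τ * p)),
        mul_nonneg (mul_nonneg (sub_nonneg.2 hr.le) (show 0 ≤ r + τ by linarith)) (sq_nonneg A)]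
    have k2 : 4 * (r - τ / 2) * u ^ 2
        ≤ q * (r - τ / 2) * A ^ 2 + q * (2 * r + τ) * p ^ 2 := by
      have k3 := mul_le_mul_of_nonneg_left k1 hα.le
      have k4 : 0 ≤ (q * (2 * r + τ) - 4 * (r - τ / 2) * r ^ 2 - 8 * τ ^ 2 * (r - τ / 2))
          * p ^ 2 := by
        refine mul_nonneg ?_ (sq_nonneg p)
        have : q * (2 * r + τ) - 4 * (r - τ / 2) * r ^ 2 - 8 * τ ^ 2 * (r - τ / 2)
          = 4 * r * (r - τ) * (r + τ) + 6 * r ^ 2 * τ + 6 * τ ^ 3 := by rw [hq]; ring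
        rw [this]
        have := sub_pos.2 hr
        positivity
      have k5 : q * (r - τ / 2) * A ^ 2 + q * (2 * r + τ) * p ^ 2 - 4 * (r - τ / 2) * u ^ 2
        = (r - τ / 2) * ((4 * r ^ 2 - 2 * τ ^ 2) * A ^ 2 + 8 * τ ^ 2 * p ^ 2)
          - (r - τ / 2) * (8 * (r * τ) * (A * p))
          + (q * (2 * r + τ) - 4 * (r - τ / 2) * r ^ 2 - 8 * τ ^ 2 * (r - τ / 2)) * p ^ 2 := by
        rw [hu, hq]; ring
      linarith
    have k6 := mul_le_mul_of_nonneg_left k2 hs0.le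
    have k7 : s * (2 * r + τ) * (q * p ^ 2) ≤ s ^ 2 / 2 * (q * p ^ 2) := by
      refine mul_le_mul_of_nonneg_right ?_ (by positivity)
      nlinarith
    have k8 : 0 ≤ 4 * q * (u ^ 2 - r ^ 2 * p ^ 2) := by
      have : u ^ 2 - r ^ 2 * p ^ 2 = τ ^ 2 * A ^ 2 + 2 * τ * r * (A * p) := by rw [hu]; ring
      rw [this]; positivity
    have k9 : e * u ^ 2 = s * (r - τ / 2) * u ^ 2 - q * u ^ 2 := by rw [he]; ring
    have k10 : q * ((e + q) * A ^ 2) = s * (q * (r - τ / 2) * A ^ 2) := by rw [he]; ring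
    linarith
  have hx2 : 2 * r ^ 2 * A0 ^ 2 = 2 * x ^ 2 := by rw [hx]; ring
  rw [hx2]
  have hqe0 : 0 < q * e := by positivity
  refine le_of_mul_le_mul_left ?_ hqe0
  have h7 := mul_le_mul_of_nonneg_left hU (show 0 ≤ e ^ 2 by positivity)
  nlinarith

/-- The scalar core of the argument. -/
lemma core {s r τ e t : ℝ} (hτ : 0 < τ) (hr : τ < r)
    (he : e = s * (r - τ / 2) - (4 * r ^ 2 + 2 * τ ^ 2)) (hepos : 0 < e)
    (A p y : ℕ → ℝ) (hy0 : ∀ k, 0 ≤ y k) (hA0 : ∀ k, 0 ≤ A k) (hp0 : ∀ k, 0 ≤ p k)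
    (h1 : y 1 ≤ (τ * A 1 + r * p 1 + r * A 0) ^ 2)
    (hk : ∀ k, 1 ≤ k → y (k + 1) ≤ (τ * A (k + 1) + r * p (k + 1) + r * p k) ^ 2)
    (K : ℕ) (hK : 1 ≤ K)
    (htot : ∑ k ∈ Finset.range K, ((e + (4 * r ^ 2 + 2 * τ ^ 2)) * A (k + 1) ^ 2
      + s ^ 2 / 2 * p (k + 1) ^ 2 - y (k + 1)) + 2 * r ^ 2 * A 0 ^ 2 + y K ≤ K * t) :
    ∃ k, 1 ≤ k ∧ k ≤ K ∧ e * A k ^ 2 ≤ t ∧ y k ≤ t := by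
  have hs : 2 * (2 * r + τ) ≤ s := s_lower hτ hr (he ▸ hepos)
  have hr0 : 0 < r := hτ.trans hr
  have hmid : ∀ k, 4 * (τ * A k + r * p k) ^ 2 + 4 * r ^ 2 * p k ^ 2
      ≤ (4 * r ^ 2 + 2 * τ ^ 2) * A k ^ 2 + s ^ 2 / 2 * p k ^ 2 :=
    fun k => mid_bound hτ hr hs
  have hy1 : y 1 ≤ 2 * (τ * A 1 + r * p 1) ^ 2 + 2 * r ^ 2 * A 0 ^ 2 := by
    have := two_sq (τ * A 1 + r * p 1) (r * A 0)
    nlinarith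
  have hyk : ∀ k, 1 ≤ k → y (k + 1) ≤ 2 * (τ * A (k + 1) + r * p (k + 1)) ^ 2
      + 2 * r ^ 2 * p k ^ 2 := by
    intro k h
    have := two_sq (τ * A (k + 1) + r * p (k + 1)) (r * p k)
    have := hk k h
    nlinarith
  have heA : ∀ k, 0 ≤ e * A k ^ 2 := fun k => by positivity
  set q := 4 * r ^ 2 + 2 * τ ^ 2 with hq
  have hq0 : 0 < q := by positivity
  set T : ℕ → ℝ := fun k => (e + q) * A k ^ 2 + s ^ 2 / 2 * p k ^ 2 - y k with hT
  have htot' : ∑ k ∈ Finset.range K, T (k + 1) + 2 * r ^ 2 * A 0 ^ 2 + y K ≤ K * t := htot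
  by_contra hcon
  push Not at hcon
  have hviol : ∀ k, 1 ≤ k → k ≤ K → t < e * A k ^ 2 ∨ t < y k := by
    intro k hk1 hk2
    by_cases h : e * A k ^ 2 ≤ t
    · exact Or.inr (hcon k hk1 hk2 h)
    · exact Or.inl (not_le.1 h)
  -- base
  have hbase : 4 * r ^ 2 * p 1 ^ 2 ≤ T 1 + 2 * r ^ 2 * A 0 ^ 2 := by
    have := hmid 1
    have := heA 1
    simp only [hT]
    nlinarith [sq_nonneg (τ * A 1 + r * p 1)]
  -- induction
  have hind : ∀ (R t' : ℝ), R + 4 * r ^ 2 * p 1 ^ 2 ≤ T 1 + 2 * r ^ 2 * A 0 ^ 2 →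
      ∀ m, (∀ k, 1 ≤ k → k ≤ m + 1 → t' ≤ e * A k ^ 2 ∨ t' ≤ y k) →
      m * t' + R + 4 * r ^ 2 * p (m + 1) ^ 2
        ≤ ∑ k ∈ Finset.range (m + 1), T (k + 1) + 2 * r ^ 2 * A 0 ^ 2 := by
    intro R t' hR m
    induction m with
    | zero => intro _; simpa using hR
    | succ m ih =>
      intro hv
      have ih' := ih (fun k a b => hv k a (by omega))
      rw [Finset.sum_range_succ]
      have a1 := hmid (m + 1 + 1)
      have a2 := hyk (m + 1) (by omega)
      have a3 : t' - 2 * y (m + 1 + 1) ≤ e * A (m + 1 + 1) ^ 2 - y (m + 1 + 1) := by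
        have := heA (m + 1 + 1)
        have := hy0 (m + 1 + 1)
        rcases hv (m + 1 + 1) (by omega) le_rfl with h | h <;> linarith
      have a4 : T (m + 1 + 1) = e * A (m + 1 + 1) ^ 2 - y (m + 1 + 1)
          + (q * A (m + 1 + 1) ^ 2 + s ^ 2 / 2 * p (m + 1 + 1) ^ 2) := by simp only [hT]; ring
      push_cast
      linarith
  have hKpos : (0 : ℝ) < K := by exact_mod_cast hK
  have ht : 0 ≤ t := by
    obtain ⟨m, rfl⟩ : ∃ m, K = m + 1 := ⟨K - 1, by omega⟩
    have h := hind 0 0 (by simpa using hbase) m (fun k _ _ => Or.inl (heA k))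
    have h2 : 0 ≤ 4 * r ^ 2 * p (m + 1) ^ 2 := by positivity
    have h3 := hy0 (m + 1)
    have : 0 ≤ ((m + 1 : ℕ) : ℝ) * t := by linarith
    exact nonneg_of_mul_nonneg_right this hKpos
  rcases Nat.lt_or_ge K 2 with hK2 | hK2
  · obtain rfl : K = 1 := by omega
    simp only [Finset.sum_range_one, zero_add, Nat.cast_one, one_mul, hT] at htot'
    have b1 := hmid 1
    have b2 := heA 1
    have b3 : 0 ≤ 4 * r ^ 2 * p 1 ^ 2 := by positivity
    have b4 := sq_nonneg (τ * A 1 + r * p 1)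
    have b5 : 0 ≤ 2 * r ^ 2 * A 0 ^ 2 := by positivity
    rcases hviol 1 le_rfl le_rfl with h | h <;> linarith
  · obtain ⟨m, rfl⟩ : ∃ m, K = m + 1 + 1 := ⟨K - 2, by omega⟩
    have hv : ∀ k, 1 ≤ k → k ≤ m + 1 → t ≤ e * A k ^ 2 ∨ t ≤ y k := fun k a b =>
      (hviol k a (by omega)).imp le_of_lt le_of_lt
    rw [Finset.sum_range_succ] at htot'
    have h0 := hind 0 t (by simpa using hbase) m hv
    have a1 := hmid (m + 1 + 1)
    have a2 := hyk (m + 1) (by omega)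
    have a4 : T (m + 1 + 1) = e * A (m + 1 + 1) ^ 2 - y (m + 1 + 1)
          + (q * A (m + 1 + 1) ^ 2 + s ^ 2 / 2 * p (m + 1 + 1) ^ 2) := by simp only [hT]; ring
    have a5 := heA (m + 1 + 1)
    have a6 : 0 ≤ 4 * r ^ 2 * p (m + 1 + 1) ^ 2 := by positivity
    have a7 : 0 ≤ s ^ 2 / 2 * p (m + 1 + 1) ^ 2 := by positivity
    have a8 : 0 ≤ 4 * r ^ 2 * p (m + 1) ^ 2 := by positivity
    push_cast at htot'
    rcases hviol (m + 1 + 1) (by omega) le_rfl with h | h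
    · -- type 1 at the last step
      rcases le_or_gt e q with hqe | hqe
      · have : e * A (m + 1 + 1) ^ 2 ≤ q * A (m + 1 + 1) ^ 2 :=
          mul_le_mul_of_nonneg_right hqe (sq_nonneg _)
        linarith
      · -- R = (e - q) t / e
        have hR : (e - q) * t / e + 4 * r ^ 2 * p 1 ^ 2 ≤ T 1 + 2 * r ^ 2 * A 0 ^ 2 := by
          rcases hviol 1 le_rfl (by omega) with h' | h'
          · have c1 : (e - q) * t / e ≤ t := by
              rw [div_le_iff₀ hepos]; have := mul_nonneg hq0.le ht; linarith
            have c2 := hmid 1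
            have c3 := sq_nonneg (τ * A 1 + r * p 1)
            simp only [hT]
            linarith
          · have c := first_step hτ hr he hepos hqe ht h' (hA0 1) (hp0 1) h1
            rw [← hq] at c
            have : (e - q) * t / e ≤ (e + q) * A 1 ^ 2 + s ^ 2 / 2 * p 1 ^ 2 - y 1
                + 2 * r ^ 2 * A 0 ^ 2 - 4 * r ^ 2 * p 1 ^ 2 := by
              rw [div_le_iff₀ hepos]; linarith
            simp only [hT]
            linarith
        have hfin := hind _ t hR m hv
        have c4 : t - (e - q) * t / e < q * A (m + 1 + 1) ^ 2 := by
          have : t - (e - q) * t / e = q * t / e := by field_simp; ring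
          rw [this, div_lt_iff₀ hepos]
          have := mul_lt_mul_of_pos_left h hq0
          linarith
        linarith
    · linarith

variable {E F : Type*} [NormedAddCommGroup E] [InnerProductSpace ℝ E] [CompleteSpace E]
  [NormedAddCommGroup F] [InnerProductSpace ℝ F] [CompleteSpace F]

lemma grad_eq {M : E → ℝ} {m b x : E} {C : ℝ} (hm : HasGradientAt M m x)
    (h : ∀ u, M x + ⟪b, u - x⟫ - C * ‖u - x‖ ^ 2 ≤ M u) : m = b := by
  have hF : HasFDerivAt (fun u => M u - ⟪b, u - x⟫ + C * ‖u - x‖ ^ 2)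
      (InnerProductSpace.toDual ℝ E m - InnerProductSpace.toDual ℝ E b) x := by
    have h1 := hm.hasFDerivAt
    have h2 : HasFDerivAt (fun u : E => ⟪b, u - x⟫) (InnerProductSpace.toDual ℝ E b) x := by
      have h := (InnerProductSpace.toDual ℝ E b).hasFDerivAt (x := x)
      have h' := h.sub_const (InnerProductSpace.toDual ℝ E b x)
      refine h'.congr_of_eventuallyEq (Filter.Eventually.of_forall fun u => ?_)
      simp [inner_sub_right]
    have h3 : HasFDerivAt (fun u : E => C * ‖u - x‖ ^ 2) (0 : E →L[ℝ] ℝ) x := by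
      have := (((hasFDerivAt_id (𝕜 := ℝ) x).sub_const x).norm_sq).const_mul C
      simpa using this
    have h4 := (h1.sub h2).add h3
    rw [add_zero] at h4
    exact h4
  have hmin : IsLocalMin (fun u => M u - ⟪b, u - x⟫ + C * ‖u - x‖ ^ 2) x := by
    refine Filter.Eventually.of_forall fun u => ?_
    have := h u
    simp only [sub_self, inner_zero_right, norm_zero]
    linarith
  have := hmin.hasFDerivAt_eq_zero hF
  exact (InnerProductSpace.toDual ℝ E).injective (sub_eq_zero.1 this)

lemma prox_subgrad {g : E → ℝ} {c τ : ℝ} 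
    (hg : ConvexOn ℝ Set.univ (fun w => g w + c / 2 * ‖w‖ ^ 2)) {x p : E}
    (hp : ∀ u, g p + τ / 2 * ‖p - x‖ ^ 2 ≤ g u + τ / 2 * ‖u - x‖ ^ 2) (u : E) :
    g p + ⟪τ • (x - p), u - p⟫ - c / 2 * ‖u - p‖ ^ 2 ≤ g u := by
  have key : ∀ t : ℝ, 0 < t → t < 1 →
      g p + ⟪τ • (x - p), u - p⟫ - c / 2 * ‖u - p‖ ^ 2 - g u
        ≤ t * ((τ / 2 - c / 2) * ‖u - p‖ ^ 2) := by
    intro t h0 h1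
    have hc := hg.2 (Set.mem_univ p) (Set.mem_univ u) (sub_nonneg.2 h1.le) h0.le (by ring)
    have hm := hp (p + t • (u - p))
    have e1 : (1 - t) • p + t • u = p + t • (u - p) := by module
    rw [e1] at hc
    simp only [smul_eq_mul] at hc
    have e2 : ‖p + t • (u - p)‖ ^ 2 = ‖p‖ ^ 2 + 2 * t * ⟪p, u - p⟫ + t ^ 2 * ‖u - p‖ ^ 2 := by
      rw [norm_add_sq_real, real_inner_smul_right, norm_smul, mul_pow, Real.norm_eq_abs, sq_abs]
      ring
    have e3 : ‖u‖ ^ 2 = ‖p‖ ^ 2 + 2 * ⟪p, u - p⟫ + ‖u - p‖ ^ 2 := by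
      rw [← norm_add_sq_real]; simp
    have e4 : ‖p + t • (u - p) - x‖ ^ 2
        = ‖p - x‖ ^ 2 - 2 * t * ⟪x - p, u - p⟫ + t ^ 2 * ‖u - p‖ ^ 2 := by
      have : p + t • (u - p) - x = (p - x) + t • (u - p) := by abel
      rw [this, norm_add_sq_real, real_inner_smul_right, norm_smul, mul_pow, Real.norm_eq_abs,
        sq_abs, ← neg_sub x p, inner_neg_left]
      ring
    rw [e2, e3] at hc
    rw [e4] at hm
    rw [real_inner_smul_left]
    refine le_of_mul_le_mul_left ?_ h0
    nlinarith
  by_contra hcon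
  push Not at hcon
  set X := g p + ⟪τ • (x - p), u - p⟫ - c / 2 * ‖u - p‖ ^ 2 - g u with hX
  have hXpos : 0 < X := by rw [hX]; linarith
  set Y := (τ / 2 - c / 2) * ‖u - p‖ ^ 2
  have hd : 0 < 2 * (|Y| + X) := by positivity
  have hlt : X / (2 * (|Y| + X)) < 1 := by
    rw [div_lt_one hd]; have := abs_nonneg Y; linarith
  have := key (X / (2 * (|Y| + X))) (by positivity) hlt
  rw [div_mul_eq_mul_div, le_div_iff₀ hd] at this
  nlinarith [le_abs_self Y, abs_nonneg Y]

lemma moreau_lower {g : E → ℝ} {c τ : ℝ} (hτ : 0 < τ) (hcτ : c ≤ τ / 3) {x u px pu : E}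
    (hs : g px + ⟪τ • (x - px), pu - px⟫ - c / 2 * ‖pu - px‖ ^ 2 ≤ g pu) :
    g px + τ / 2 * ‖px - x‖ ^ 2 + ⟪τ • (x - px), u - x⟫ - τ / 2 * ‖u - x‖ ^ 2
      ≤ g pu + τ / 2 * ‖pu - u‖ ^ 2 := by
  set f := pu - px with hf
  set e := u - x with he
  obtain ⟨q, hq⟩ : ∃ q, q = x - px := ⟨_, rfl⟩
  rw [← hq] at hs ⊢
  have e1 : pu - u = f - (e + q) := by rw [hf, he, hq]; abel
  have e2 : px - x = -q := by rw [hq]; abel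
  rw [e1, e2, norm_neg, norm_sub_sq_real f, norm_add_sq_real, inner_add_right]
  rw [real_inner_smul_left] at hs ⊢
  rw [real_inner_comm q f, real_inner_comm q e]
  have hcs := real_inner_le_norm f e
  have h1 : c * ‖f‖ ^ 2 ≤ τ / 3 * ‖f‖ ^ 2 := mul_le_mul_of_nonneg_right hcτ (sq_nonneg _)
  have h2 : 0 ≤ τ * (2 / 3 * ‖f‖ ^ 2 - 2 * ⟪f, e⟫ + 2 * ‖e‖ ^ 2) := by
    refine mul_nonneg hτ.le ?_
    nlinarith [sq_nonneg (2 * ‖f‖ - 3 * ‖e‖), sq_nonneg ‖e‖]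
  nlinarith

lemma moreau_lip {g : E → ℝ} {c τ : ℝ} (hτ : 0 < τ) (hcτ : c ≤ τ / 3) {x u px pu : E}
    (h1 : g px + ⟪τ • (x - px), pu - px⟫ - c / 2 * ‖pu - px‖ ^ 2 ≤ g pu)
    (h2 : g pu + ⟪τ • (u - pu), px - pu⟫ - c / 2 * ‖px - pu‖ ^ 2 ≤ g px) :
    ‖τ • (u - pu) - τ • (x - px)‖ ≤ τ * ‖u - x‖ := by
  rw [← smul_sub, norm_smul, Real.norm_eq_abs, abs_of_pos hτ]
  refine mul_le_mul_of_nonneg_left ?_ hτ.le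
  set f := pu - px with hf
  set e := u - x with he
  have e1 : u - pu - (x - px) = e - f := by rw [hf, he]; abel
  have e2 : px - pu = -f := by rw [hf]; abel
  have e3 : u - pu = (x - px) + (e - f) := by rw [hf, he]; abel
  rw [e1]
  rw [e2, e3, norm_neg, real_inner_smul_left, inner_neg_right, inner_add_left, inner_sub_left e f,
    real_inner_self_eq_norm_sq] at h2
  rw [real_inner_smul_left] at h1
  have h3 : c * ‖f‖ ^ 2 ≤ τ / 3 * ‖f‖ ^ 2 := mul_le_mul_of_nonneg_right hcτ (sq_nonneg _)
  have h4 : τ * (2 / 3 * ‖f‖ ^ 2) ≤ τ * ⟪e, f⟫ := by nlinarith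
  have h5 := le_of_mul_le_mul_left h4 hτ
  refine le_of_sq_le_sq ?_ (norm_nonneg _)
  rw [norm_sub_sq_real]
  nlinarith [sq_nonneg ‖f‖]

end ADMMAux

set_option maxHeartbeats 2000000 in
/-- **Theorem 2: the smoothed proximal ADMM finds an ε-KKT point in `O(1/ε⁴)`
iterations** (stated with explicit bounds).  With `Ω(z) = ∑ᵢ σᵢ l(z₍ᵢ₎)` (sorted
entries), `g ≥ 0` proper, lsc and `c`-weakly convex, `0 < cγ ≤ 1/3`, `r > γ⁻¹`,
`M = M_{g,γ}` the Moreau envelope (with gradient `∇M` bounded by `M_b`),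
`L^M_ρ(w,z;λ) = Ω(z) + ⟪λ, z - Dw⟫ + (ρ/2)‖z - Dw‖² + M(w)`,
`Φᵏ = L^M_ρ(wᵏ,zᵏ;λᵏ) + (2r²/(σρ))‖wᵏ - wᵏ⁻¹‖²`,
`E₁ = (2r - γ⁻¹)/2 - 4r²/(σρ) - 2/(σργ²) > 0`, smoothed-ADMM iterates with
`z`-descent, exact `w`-minimization, dual updates, `zᵏ ∈ Im(D)`, `‖λᵏ‖ ≤ Λ`, and
`B = Φ¹ + Λ²/(2ρ)`, for every `K ≥ 1` there is `1 ≤ k ≤ K` such that, with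
`w̃ᵏ⁺¹ = prox_{g,γ}(wᵏ⁺¹)`:
(i) `‖wᵏ⁺¹-wᵏ‖ ≤ √(B/(E₁K))` and `‖λᵏ⁺¹-λᵏ‖ ≤ √(ρB/K)`;
(ii) a `c`-subgradient `v` of `g` at `w̃ᵏ⁺¹` with `‖D^⊤λᵏ⁺¹ - v‖ ≤ r√(B/(E₁K))`,
and `ξ = -λᵏ - ρ(zᵏ⁺¹ - Dwᵏ)` satisfies `‖ξ + λᵏ⁺¹‖ ≤ ρ‖D‖√(B/(E₁K))`;
(iii) `‖zᵏ⁺¹ - Dw̃ᵏ⁺¹‖ ≤ √(B/(ρK)) + γ‖D‖M_b`. -/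
theorem smoothed_admm_eps_kkt (n d : ℕ) (hn : 1 ≤ n) (hd : 1 ≤ d)
    (D : EuclideanSpace ℝ (Fin d) →L[ℝ] EuclideanSpace ℝ (Fin n))
    (hD : D ≠ 0)
    (σ : ℝ) (hσpos : 0 < σ)
    (hσ : ∀ v ∈ Set.range (fun x => D x),
      σ * ‖v‖ ^ 2 ≤ ‖(ContinuousLinearMap.adjoint D) v‖ ^ 2)
    (ρ : ℝ) (hρ : 0 < ρ)
    (sw : Fin n → ℝ) (hsw : ∀ i, 0 ≤ sw i)
    (l : ℝ → ℝ) (hl_conv : ConvexOn ℝ Set.univ l) (hl_mono : Monotone l)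
    (hl_nonneg : ∀ t, 0 ≤ l t)
    (Ω : EuclideanSpace ℝ (Fin n) → ℝ)
    (hΩ : ∀ z, Ω z = ∑ i : Fin n, sw i * l (z (Tuple.sort (fun j => z j) i)))
    (g : EuclideanSpace ℝ (Fin d) → ℝ)
    (hg_lsc : LowerSemicontinuous g)
    (hg_nonneg : ∀ w, 0 ≤ g w)
    (c : ℝ) (hc : 0 < c)
    (hg_wc : ConvexOn ℝ Set.univ (fun w => g w + c / 2 * ‖w‖ ^ 2))
    (γ : ℝ) (hγ : 0 < γ) (hcγ : c * γ ≤ 1 / 3)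
    (M : EuclideanSpace ℝ (Fin d) → ℝ)
    (hM : ∀ w, M w = ⨅ x : EuclideanSpace ℝ (Fin d),
      (g x + 1 / (2 * γ) * ‖x - w‖ ^ 2))
    (prox : EuclideanSpace ℝ (Fin d) → EuclideanSpace ℝ (Fin d))
    (hprox : ∀ x u, g (prox x) + 1 / (2 * γ) * ‖prox x - x‖ ^ 2
      ≤ g u + 1 / (2 * γ) * ‖u - x‖ ^ 2)
    (M' : EuclideanSpace ℝ (Fin d) → EuclideanSpace ℝ (Fin d))
    (hM' : ∀ x, HasGradientAt M (M' x) x)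
    (Mb : ℝ) (hMb : ∀ x, ‖M' x‖ ≤ Mb)
    (r : ℝ) (hr : γ⁻¹ < r)
    (LM : EuclideanSpace ℝ (Fin d) → EuclideanSpace ℝ (Fin n) →
      EuclideanSpace ℝ (Fin n) → ℝ)
    (hLM : ∀ w z lam, LM w z lam
      = Ω z + ⟪lam, z - D w⟫ + ρ / 2 * ‖z - D w‖ ^ 2 + M w)
    (w : ℕ → EuclideanSpace ℝ (Fin d))
    (z lam : ℕ → EuclideanSpace ℝ (Fin n))
    (Φ : ℕ → ℝ)
    (hΦ : ∀ j, Φ j = LM (w j) (z j) (lam j)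
      + 2 * r ^ 2 / (σ * ρ) * ‖w j - w (j - 1)‖ ^ 2)
    (E₁ : ℝ)
    (hE₁ : E₁ = (2 * r - γ⁻¹) / 2 - 4 * r ^ 2 / (σ * ρ) - 2 / (σ * ρ * γ ^ 2))
    (hE₁pos : 0 < E₁)
    (ha : ∀ k, LM (w k) (z k) (lam k) ≥ LM (w k) (z (k + 1)) (lam k))
    (hb : ∀ k, ∀ u,
      ρ / 2 * ‖z (k + 1) - D (w (k + 1)) + ρ⁻¹ • lam k‖ ^ 2 + M (w (k + 1))
          + r / 2 * ‖w (k + 1) - w k‖ ^ 2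
        ≤ ρ / 2 * ‖z (k + 1) - D u + ρ⁻¹ • lam k‖ ^ 2 + M u
          + r / 2 * ‖u - w k‖ ^ 2)
    (hc' : ∀ k, lam (k + 1) = lam k + ρ • (z (k + 1) - D (w (k + 1))))
    (hzr : ∀ k, z k ∈ Set.range (fun x => D x))
    (Λ : ℝ) (hΛ : ∀ k, ‖lam k‖ ≤ Λ)
    (B : ℝ) (hB : B = Φ 1 + Λ ^ 2 / (2 * ρ)) :
    ∀ K : ℕ, 1 ≤ K → ∃ k, 1 ≤ k ∧ k ≤ K ∧
      ‖w (k + 1) - w k‖ ≤ Real.sqrt (B / (E₁ * K)) ∧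
      ‖lam (k + 1) - lam k‖ ≤ Real.sqrt (ρ * B / K) ∧
      (∃ v, (∀ u, g u ≥ g (prox (w (k + 1)))
          + ⟪v, u - prox (w (k + 1))⟫
          - c / 2 * ‖u - prox (w (k + 1))‖ ^ 2) ∧
        ‖(ContinuousLinearMap.adjoint D) (lam (k + 1)) - v‖
          ≤ r * Real.sqrt (B / (E₁ * K))) ∧
      ‖(-(lam k) - ρ • (z (k + 1) - D (w k))) + lam (k + 1)‖
        ≤ ρ * ‖D‖ * Real.sqrt (B / (E₁ * K)) ∧
      ‖z (k + 1) - D (prox (w (k + 1)))‖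
        ≤ Real.sqrt (B / (ρ * K)) + γ * ‖D‖ * Mb := by
  intro K hK
  have hKpos : (0 : ℝ) < K := by exact_mod_cast hK
  obtain ⟨τ, hτdef⟩ : ∃ τ, τ = γ⁻¹ := ⟨_, rfl⟩
  have hτ : 0 < τ := by rw [hτdef]; positivity
  have hτγ : τ * γ = 1 := by rw [hτdef]; field_simp
  have hhalf : 1 / (2 * γ) = τ / 2 := by rw [hτdef]; field_simp
  have hcτ : c ≤ τ / 3 := by
    have : c * γ * τ ≤ 1 / 3 * τ := mul_le_mul_of_nonneg_right hcγ hτ.le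
    have h2 : c * γ * τ = c := by rw [mul_assoc, mul_comm γ τ, hτγ, mul_one]
    linarith
  rw [← hτdef] at hr hE₁
  have hr0 : 0 < r := hτ.trans hr
  simp only [hhalf] at hM hprox
  -- Moreau envelope facts
  have hMeq : ∀ x, M x = g (prox x) + τ / 2 * ‖prox x - x‖ ^ 2 := by
    intro x
    rw [hM]
    refine le_antisymm (ciInf_le ⟨0, ?_⟩ (prox x)) (le_ciInf (hprox x))
    rintro _ ⟨u, rfl⟩
    have := hg_nonneg u
    positivity
  have hM0 : ∀ x, 0 ≤ M x := by
    intro x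
    rw [hMeq]
    have := hg_nonneg (prox x)
    positivity
  have hsub : ∀ x u, g (prox x) + ⟪τ • (x - prox x), u - prox x⟫
      - c / 2 * ‖u - prox x‖ ^ 2 ≤ g u :=
    fun x u => ADMMAux.prox_subgrad hg_wc (hprox x) u
  have hlow0 : ∀ x u, M x + ⟪τ • (x - prox x), u - x⟫ - τ / 2 * ‖u - x‖ ^ 2 ≤ M u := by
    intro x u
    rw [hMeq x, hMeq u]
    exact ADMMAux.moreau_lower hτ hcτ (hsub x (prox u))
  have hgrad : ∀ x, M' x = τ • (x - prox x) := fun x => ADMMAux.grad_eq (hM' x) (hlow0 x)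
  have hlow : ∀ x u, M x + ⟪M' x, u - x⟫ - τ / 2 * ‖u - x‖ ^ 2 ≤ M u := by
    intro x u; rw [hgrad]; exact hlow0 x u
  have hlip : ∀ x u, ‖M' u - M' x‖ ≤ τ * ‖u - x‖ := by
    intro x u
    rw [hgrad, hgrad]
    exact ADMMAux.moreau_lip hτ hcτ (hsub x (prox u)) (hsub u (prox x))
  -- first-order condition of the w-update
  have hopt : ∀ k, M' (w (k + 1))
      = (ContinuousLinearMap.adjoint D) (lam (k + 1)) - r • (w (k + 1) - w k) := by
    intro k
    refine ADMMAux.grad_eq (C := ρ / 2 * ‖D‖ ^ 2 + r / 2) (hM' _) ?_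
    intro u
    have h := hb k u
    obtain ⟨h', hh'⟩ : ∃ h', h' = u - w (k + 1) := ⟨_, rfl⟩
    have e1 : z (k + 1) - D (w (k + 1)) + ρ⁻¹ • lam k = ρ⁻¹ • lam (k + 1) := by
      rw [hc' k, smul_add, smul_smul, inv_mul_cancel₀ hρ.ne', one_smul, add_comm]
    have e2 : z (k + 1) - D u + ρ⁻¹ • lam k = ρ⁻¹ • lam (k + 1) - D h' := by
      rw [← e1, hh', map_sub]; abel
    have e3 : u - w k = (w (k + 1) - w k) + h' := by rw [hh']; abel
    rw [e1, e2, e3, norm_sub_sq_real (ρ⁻¹ • lam (k + 1)), norm_add_sq_real,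
      real_inner_smul_left] at h
    rw [← hh', inner_sub_left, real_inner_smul_left, ContinuousLinearMap.adjoint_inner_left]
    have e4 : ‖D h'‖ ^ 2 ≤ ‖D‖ ^ 2 * ‖h'‖ ^ 2 := by
      rw [← mul_pow]
      exact pow_le_pow_left₀ (norm_nonneg _) (D.le_opNorm h') 2
    have e5 : ρ / 2 * ‖D h'‖ ^ 2 ≤ ρ / 2 * (‖D‖ ^ 2 * ‖h'‖ ^ 2) :=
      mul_le_mul_of_nonneg_left e4 (by positivity)
    have e6 : ρ / 2 * (2 * (ρ⁻¹ * ⟪lam (k + 1), D h'⟫)) = ⟪lam (k + 1), D h'⟫ := by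
      field_simp
    linarith
  have hadj : ∀ k, (ContinuousLinearMap.adjoint D) (lam (k + 1))
      = M' (w (k + 1)) + r • (w (k + 1) - w k) := by
    intro k; rw [hopt k]; abel
  have hΩ0 : ∀ x, 0 ≤ Ω x := by
    intro x
    rw [hΩ]
    exact Finset.sum_nonneg fun i _ => mul_nonneg (hsw i) (hl_nonneg _)
  have hres : ∀ k, z (k + 1) - D (w (k + 1)) = ρ⁻¹ • (lam (k + 1) - lam k) := by
    intro k
    rw [hc' k, add_sub_cancel_left, smul_smul, inv_mul_cancel₀ hρ.ne', one_smul]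
  -- lower bound on the augmented Lagrangian
  have hLlow : ∀ k, ‖lam (k + 1) - lam k‖ ^ 2 / ρ - Λ ^ 2 / (2 * ρ)
      ≤ LM (w (k + 1)) (z (k + 1)) (lam (k + 1)) := by
    intro k
    rw [hLM, hres]
    have h1 := hΩ0 (z (k + 1))
    have h2 := hM0 (w (k + 1))
    have h3 : ‖lam k‖ ^ 2 ≤ Λ ^ 2 := pow_le_pow_left₀ (norm_nonneg _) (hΛ k) 2
    have h4 : ‖lam k‖ ^ 2 = ‖lam (k + 1)‖ ^ 2 - 2 * ⟪lam (k + 1), lam (k + 1) - lam k⟫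
        + ‖lam (k + 1) - lam k‖ ^ 2 := by
      rw [← norm_sub_sq_real]; simp
    rw [real_inner_smul_right, norm_smul, mul_pow, Real.norm_eq_abs, sq_abs]
    have h5 : ρ⁻¹ * ⟪lam (k + 1), lam (k + 1) - lam k⟫
        + ρ / 2 * (ρ⁻¹ ^ 2 * ‖lam (k + 1) - lam k‖ ^ 2)
        - (‖lam (k + 1) - lam k‖ ^ 2 / ρ - Λ ^ 2 / (2 * ρ))
        = (2 * ⟪lam (k + 1), lam (k + 1) - lam k⟫ - ‖lam (k + 1) - lam k‖ ^ 2 + Λ ^ 2)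
          / (2 * ρ) := by
      field_simp; ring
    have h6 : 0 ≤ (2 * ⟪lam (k + 1), lam (k + 1) - lam k⟫ - ‖lam (k + 1) - lam k‖ ^ 2 + Λ ^ 2)
          / (2 * ρ) := by
      refine div_nonneg ?_ (by positivity)
      nlinarith [sq_nonneg ‖lam (k + 1)‖]
    linarith
  -- one-step decrease
  have hdec : ∀ k, (r - τ / 2) * ‖w (k + 1) - w k‖ ^ 2 + ρ / 2 * ‖D (w (k + 1) - w k)‖ ^ 2
      - ‖lam (k + 1) - lam k‖ ^ 2 / ρ
      ≤ LM (w k) (z k) (lam k) - LM (w (k + 1)) (z (k + 1)) (lam (k + 1)) := by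
    intro k
    have h := ha k
    obtain ⟨a, haa⟩ : ∃ a, a = w (k + 1) - w k := ⟨_, rfl⟩
    obtain ⟨X, hX⟩ : ∃ X, X = z (k + 1) - D (w (k + 1)) := ⟨_, rfl⟩
    have e1 : z (k + 1) - D (w k) = X + D a := by rw [hX, haa, map_sub]; abel
    have e2 : LM (w k) (z (k + 1)) (lam k) = Ω (z (k + 1)) + ⟪lam k, X + D a⟫
        + ρ / 2 * ‖X + D a‖ ^ 2 + M (w k) := by rw [hLM, e1]
    have hl1 : lam (k + 1) = lam k + ρ • X := by rw [hX]; exact hc' k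
    have e3 : LM (w (k + 1)) (z (k + 1)) (lam (k + 1)) = Ω (z (k + 1)) + ⟪lam k + ρ • X, X⟫
        + ρ / 2 * ‖X‖ ^ 2 + M (w (k + 1)) := by rw [hLM, ← hX, ← hl1]
    have e4 := hlow (w (k + 1)) (w k)
    have e5 : w k - w (k + 1) = -a := by rw [haa]; abel
    have e6 : ⟪M' (w (k + 1)), a⟫ = ⟪lam k, D a⟫ + ρ * ⟪X, D a⟫ - r * ‖a‖ ^ 2 := by
      rw [hopt k, ← haa, inner_sub_left, ContinuousLinearMap.adjoint_inner_left, hl1,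
        inner_add_left, real_inner_smul_left, real_inner_smul_left, real_inner_self_eq_norm_sq]
    rw [e5, norm_neg, inner_neg_right, e6] at e4
    have e7 : ‖lam (k + 1) - lam k‖ ^ 2 / ρ = ρ * ‖X‖ ^ 2 := by
      rw [hl1, add_sub_cancel_left, norm_smul, mul_pow, Real.norm_eq_abs, sq_abs]
      field_simp
    rw [inner_add_right, norm_add_sq_real] at e2
    rw [inner_add_left, real_inner_smul_left, real_inner_self_eq_norm_sq] at e3
    rw [e7, ← haa]
    linarith
  -- bounds on the dual increments
  have hrange : ∀ k, lam (k + 1) - lam k ∈ Set.range (fun x => D x) := by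
    intro k
    obtain ⟨x, hx⟩ := hzr (k + 1)
    refine ⟨ρ • (x - w (k + 1)), ?_⟩
    simp only at hx ⊢
    rw [hc' k, add_sub_cancel_left, ← hx, map_smul, map_sub]
  have hsq : 0 < Real.sqrt σ := Real.sqrt_pos.2 hσpos
  have hsq2 : Real.sqrt σ ^ 2 = σ := Real.sq_sqrt hσpos.le
  have hT0 : ∀ k, Real.sqrt σ * ‖lam (k + 1) - lam k‖
      ≤ ‖(ContinuousLinearMap.adjoint D) (lam (k + 1) - lam k)‖ := by
    intro k
    refine le_of_sq_le_sq ?_ (norm_nonneg _)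
    rw [mul_pow, hsq2]
    exact hσ _ (hrange k)
  have hTD : ∀ k x, |⟪(ContinuousLinearMap.adjoint D) (lam (k + 1) - lam k), x⟫|
      ≤ ‖(ContinuousLinearMap.adjoint D) (lam (k + 1) - lam k)‖ * (‖D x‖ / Real.sqrt σ) := by
    intro k x
    rw [ContinuousLinearMap.adjoint_inner_left]
    refine (abs_real_inner_le_norm _ _).trans ?_
    have := mul_le_mul_of_nonneg_right (hT0 k) (show 0 ≤ ‖D x‖ / Real.sqrt σ by positivity)
    refine le_trans (le_of_eq ?_) this
    field_simp
  have hTeq : ∀ k, (ContinuousLinearMap.adjoint D) (lam (k + 1 + 1) - lam (k + 1))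
      = (M' (w (k + 1 + 1)) - M' (w (k + 1))) + r • (w (k + 1 + 1) - w (k + 1))
        - r • (w (k + 1) - w k) := by
    intro k
    rw [map_sub, hadj, hadj]; abel
  have hTgen : ∀ k (β : ℝ),
      |⟪(ContinuousLinearMap.adjoint D) (lam (k + 1 + 1) - lam (k + 1)), w (k + 1) - w k⟫|
        ≤ ‖(ContinuousLinearMap.adjoint D) (lam (k + 1 + 1) - lam (k + 1))‖ * β → 0 ≤ β →
      σ * ‖lam (k + 1 + 1) - lam (k + 1)‖ ^ 2 ≤ (τ * ‖w (k + 1 + 1) - w (k + 1)‖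
        + r * (‖D (w (k + 1 + 1) - w (k + 1))‖ / Real.sqrt σ) + r * β) ^ 2 := by
    intro k β hβ hβ0
    refine (hσ _ (hrange (k + 1))).trans ?_
    refine pow_le_pow_left₀ (norm_nonneg _) ?_ 2
    have hD1 := hTD (k + 1) (w (k + 1 + 1) - w (k + 1))
    have hm := hlip (w (k + 1)) (w (k + 1 + 1))
    have hE := hTeq k
    generalize (ContinuousLinearMap.adjoint D) (lam (k + 1 + 1) - lam (k + 1)) = T at *
    generalize M' (w (k + 1 + 1)) - M' (w (k + 1)) = m at *
    have i1 : ‖T‖ ^ 2 = ⟪T, m⟫ + r * ⟪T, w (k + 1 + 1) - w (k + 1)⟫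
        - r * ⟪T, w (k + 1) - w k⟫ := by
      rw [← real_inner_self_eq_norm_sq]
      nth_rewrite 2 [hE]
      rw [inner_sub_right, inner_add_right, real_inner_smul_right, real_inner_smul_right]
    have i2 := real_inner_le_norm T m
    have i3 := mul_le_mul_of_nonneg_left hm (norm_nonneg T)
    have i4 := mul_le_mul_of_nonneg_left ((le_abs_self _).trans hD1) hr0.le
    have i5 := mul_le_mul_of_nonneg_left ((neg_le_abs _).trans hβ) hr0.le
    rcases (norm_nonneg T).eq_or_lt with h0 | h0
    · rw [← h0]; positivity
    · refine le_of_mul_le_mul_left ?_ h0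
      linarith
  -- the scalar core
  obtain ⟨s, hs⟩ : ∃ s, s = σ * ρ := ⟨_, rfl⟩
  have hs0 : 0 < s := by rw [hs]; positivity
  have heE : s * E₁ = s * (r - τ / 2) - (4 * r ^ 2 + 2 * τ ^ 2) := by
    have : 2 / (σ * ρ * γ ^ 2) = 2 * τ ^ 2 / s := by rw [hs, hτdef]; field_simp
    rw [hE₁, this, ← hs]
    field_simp
    ring
  have hsum : ∀ m : ℕ, ∑ k ∈ Finset.range m, ((r - τ / 2) * ‖w (k + 1 + 1) - w (k + 1)‖ ^ 2
      + ρ / 2 * ‖D (w (k + 1 + 1) - w (k + 1))‖ ^ 2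
      - ‖lam (k + 1 + 1) - lam (k + 1)‖ ^ 2 / ρ)
      ≤ LM (w 1) (z 1) (lam 1) - LM (w (m + 1)) (z (m + 1)) (lam (m + 1)) := by
    intro m
    induction m with
    | zero => simp
    | succ m ih =>
      rw [Finset.sum_range_succ]
      have := hdec (m + 1)
      linarith
  obtain ⟨k, hk1, hkK, hkA, hky⟩ := ADMMAux.core (s := s) (e := s * E₁) (t := s * B / K)
    hτ hr heE (by positivity)
    (fun k => ‖w (k + 1) - w k‖) (fun k => ‖D (w (k + 1) - w k)‖ / Real.sqrt σ)
    (fun k => σ * ‖lam (k + 1) - lam k‖ ^ 2)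
    (fun k => by positivity) (fun k => by positivity) (fun k => by positivity)
    (hTgen 0 ‖w (0 + 1) - w 0‖ (abs_real_inner_le_norm _ _) (norm_nonneg _))
    (by
      intro k hk
      obtain ⟨j, rfl⟩ : ∃ j, k = j + 1 := ⟨k - 1, by omega⟩
      exact hTgen (j + 1) _ (hTD (j + 1 + 1) _) (by positivity))
    K hK
    (by
      have h1 := hsum K
      have h2 := hLlow K
      have hcong : ∑ k ∈ Finset.range K,
          ((s * E₁ + (4 * r ^ 2 + 2 * τ ^ 2)) * ‖w (k + 1 + 1) - w (k + 1)‖ ^ 2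
          + s ^ 2 / 2 * (‖D (w (k + 1 + 1) - w (k + 1))‖ / Real.sqrt σ) ^ 2
          - σ * ‖lam (k + 1 + 1) - lam (k + 1)‖ ^ 2)
          = s * ∑ k ∈ Finset.range K, ((r - τ / 2) * ‖w (k + 1 + 1) - w (k + 1)‖ ^ 2
            + ρ / 2 * ‖D (w (k + 1 + 1) - w (k + 1))‖ ^ 2
            - ‖lam (k + 1 + 1) - lam (k + 1)‖ ^ 2 / ρ) := by
        rw [Finset.mul_sum]
        refine Finset.sum_congr rfl fun k _ => ?_
        rw [heE, div_pow, hsq2, hs]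
        field_simp
        ring
      have h3 : (K : ℝ) * (s * B / K) = s * B := by field_simp
      have h4 : s * B = s * LM (w 1) (z 1) (lam 1) + 2 * r ^ 2 * ‖w (0 + 1) - w 0‖ ^ 2
          + s * (Λ ^ 2 / (2 * ρ)) := by
        rw [hB, hΦ, ← hs]
        simp only [Nat.sub_self, zero_add]
        field_simp
      have h5 := mul_le_mul_of_nonneg_left h1 hs0.le
      have h6 := mul_le_mul_of_nonneg_left h2 hs0.le
      have h7 : s * (‖lam (K + 1) - lam K‖ ^ 2 / ρ) = σ * ‖lam (K + 1) - lam K‖ ^ 2 := by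
        rw [hs]; field_simp
      rw [hcong, h3, h4]
      linarith)
  have hA : ‖w (k + 1) - w k‖ ≤ Real.sqrt (B / (E₁ * K)) := by
    refine Real.le_sqrt_of_sq_le ?_
    rw [le_div_iff₀ (by positivity)]
    rw [le_div_iff₀ hKpos] at hkA
    refine le_of_mul_le_mul_left ?_ hs0
    linarith
  have hL : ‖lam (k + 1) - lam k‖ ≤ Real.sqrt (ρ * B / K) := by
    refine Real.le_sqrt_of_sq_le ?_
    rw [le_div_iff₀ hKpos]
    rw [le_div_iff₀ hKpos, hs] at hky
    refine le_of_mul_le_mul_left ?_ hσpos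
    linarith
  refine ⟨k, hk1, hkK, hA, hL, ⟨M' (w (k + 1)), ?_, ?_⟩, ?_, ?_⟩
  · intro u
    rw [hgrad]
    exact hsub _ u
  · rw [hadj, add_sub_cancel_left, norm_smul, Real.norm_eq_abs, abs_of_pos hr0]
    exact mul_le_mul_of_nonneg_left hA hr0.le
  · have e : (-(lam k) - ρ • (z (k + 1) - D (w k))) + lam (k + 1)
        = -(ρ • D (w (k + 1) - w k)) := by
      rw [hc' k, map_sub]; module
    rw [e, norm_neg, norm_smul, Real.norm_eq_abs, abs_of_pos hρ, mul_assoc]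
    refine mul_le_mul_of_nonneg_left ?_ hρ.le
    exact (D.le_opNorm _).trans (mul_le_mul_of_nonneg_left hA (norm_nonneg _))
  · have e : z (k + 1) - D (prox (w (k + 1)))
        = ρ⁻¹ • (lam (k + 1) - lam k) + D (w (k + 1) - prox (w (k + 1))) := by
      rw [← hres, map_sub]; abel
    rw [e]
    refine (norm_add_le _ _).trans (add_le_add ?_ ?_)
    · rw [norm_smul, Real.norm_eq_abs, abs_of_pos (inv_pos.2 hρ)]
      refine Real.le_sqrt_of_sq_le ?_
      rw [le_div_iff₀ hKpos, hs] at hky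
      rw [le_div_iff₀ (by positivity)]
      have h1 : ‖lam (k + 1) - lam k‖ ^ 2 * K ≤ ρ * B :=
        le_of_mul_le_mul_left (by linarith) hσpos
      have h2 : (ρ⁻¹ * ‖lam (k + 1) - lam k‖) ^ 2 * (ρ * K)
          = ρ⁻¹ * (‖lam (k + 1) - lam k‖ ^ 2 * K) := by field_simp
      rw [h2]
      refine (mul_le_mul_of_nonneg_left h1 (inv_pos.2 hρ).le).trans (le_of_eq ?_)
      field_simp
    · have e2 : w (k + 1) - prox (w (k + 1)) = γ • M' (w (k + 1)) := by
        rw [hgrad, smul_smul, mul_comm, hτγ, one_smul]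
      rw [e2]
      refine (D.le_opNorm _).trans ?_
      rw [norm_smul, Real.norm_eq_abs, abs_of_pos hγ]
      have := mul_le_mul_of_nonneg_left (hMb (w (k + 1)))
        (show 0 ≤ γ * ‖D‖ by positivity)
      linarith
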